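/- arXiv:1706.02394 — 5 statements merged into one kernel-verified Lean document; each statement's English description precedes it below -/
import Mathlib

section
/- Let v1, v2, v3 be positive real numbers with v2^2 = v1^2 + v3^2, let V1, V2, V3 be real numbers, and let H be a real number. Then the three conditions (a) v1*V1 - v2*V2 + v3*V3 = 0, (b) V1^2 - V2^2 + V3^2 = 1, (c) H = V1/v1 + V2/v2 + V3/v3 hold simultaneously if and only if there exists λ ∈ {-1, 1} such that V1 = -(λ/3)(v2/v3 + v3/v2) + (v1/3)H, V2 = -(λ/3)(v1/v3 - v3/v1) + (v2/3)H, and V3 = (λ/3)(v1/v2 + v2/v1) + (v3/3)H. -/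
/-- Pointwise algebraic content of Corollary 1.2: for positive `v₁, v₂, v₃` with
`v₂² = v₁² + v₃²`, the conditions that `V` is a unit space-like vector orthogonal to the
light-like vector `v` (in the Lorentz inner product `x₁y₁ - x₂y₂ + x₃y₃`) together with the
mean curvature relation hold iff `V` has the stated form for some `λ = ±1`. -/
theorem statement_0 (v1 v2 v3 V1 V2 V3 H : ℝ)
    (hv1 : 0 < v1) (hv2 : 0 < v2) (hv3 : 0 < v3)
    (hsum : v2 ^ 2 = v1 ^ 2 + v3 ^ 2) :
    (v1 * V1 - v2 * V2 + v3 * V3 = 0 ∧ V1 ^ 2 - V2 ^ 2 + V3 ^ 2 = 1 ∧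
        H = V1 / v1 + V2 / v2 + V3 / v3) ↔
      ∃ lam : ℝ, (lam = -1 ∨ lam = 1) ∧
        V1 = -(lam / 3) * (v2 / v3 + v3 / v2) + (v1 / 3) * H ∧
        V2 = -(lam / 3) * (v1 / v3 - v3 / v1) + (v2 / 3) * H ∧
        V3 = (lam / 3) * (v1 / v2 + v2 / v1) + (v3 / 3) * H := by
  constructor
  · rintro ⟨horth, hunit, hH⟩
    have hdet : (v1 * V3 - v3 * V1) ^ 2 = v2 ^ 2 := by
      linear_combination (-(v1 * V1 + v3 * V3) - v2 * V2) * horth + v2 ^ 2 * hunit -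
        (V1 ^ 2 + V3 ^ 2) * hsum
    have key : ∀ lam : ℝ, v1 * V3 - v3 * V1 = lam * v2 →
        V1 = -(lam / 3) * (v2 / v3 + v3 / v2) + (v1 / 3) * H ∧
        V2 = -(lam / 3) * (v1 / v3 - v3 / v1) + (v2 / 3) * H ∧
        V3 = (lam / 3) * (v1 / v2 + v2 / v1) + (v3 / 3) * H := by
      intro lam hlam
      have hV3 : V3 = (lam * v2 + v3 * V1) / v1 := by
        field_simp
        linarith
      have hV2 : V2 = (v2 * V1 + lam * v3) / v1 := by
        have h : v2 * (v1 * V2) = v2 * (v2 * V1 + lam * v3) := by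
          linear_combination -v1 * horth + v3 * hlam - V1 * hsum
        have h' := mul_left_cancel₀ hv2.ne' h
        field_simp
        linarith
      subst hV3 hV2 hH
      refine ⟨?_, ?_, ?_⟩
      · field_simp
        ring
      · field_simp
        linear_combination -lam * hsum
      · field_simp
        linear_combination lam * hsum
    rcases sq_eq_sq_iff_eq_or_eq_neg.mp hdet with h | h
    · exact ⟨1, Or.inr rfl, key 1 (by linarith)⟩
    · exact ⟨-1, Or.inl rfl, key (-1) (by linarith)⟩
  · rintro ⟨lam, hlam, rfl, rfl, rfl⟩
    have hlam2 : lam ^ 2 = 1 := by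
      rcases hlam with rfl | rfl <;> norm_num
    have hcross : v1 * (v2 / v3 + v3 / v2) - v2 * (v1 / v3 - v3 / v1) -
        v3 * (v1 / v2 + v2 / v1) = 0 := by
      field_simp
      ring
    have hnorm : (v2 / v3 + v3 / v2) ^ 2 - (v1 / v3 - v3 / v1) ^ 2 +
        (v1 / v2 + v2 / v1) ^ 2 = 9 := by
      field_simp
      linear_combination (v1 ^ 2 * v2 ^ 2 + v2 ^ 2 * v3 ^ 2 - v1 ^ 2 * v3 ^ 2) * hsum
    refine ⟨?_, ?_, ?_⟩
    · linear_combination -(lam / 3) * hcross - H / 3 * hsum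
    · linear_combination lam ^ 2 / 9 * hnorm + hlam2 - 2 * lam * H / 9 * hcross - H ^ 2 / 9 * hsum
    · field_simp
      ring
end

section
/- Under the holonomic system hypotheses with the conformally flat constant-mean-curvature ansatz, define α1 := (1/v2) ∂v2/∂u1, α2 := (1/v3) ∂v3/∂u2, α3 := (1/v1) ∂v1/∂u3. Then on U: ∂v1/∂u1 = (v1/v2^4)(v2^4 + v2^2 v3^2 + v3^4) α1, ∂v2/∂u1 = v2 α1, ∂v3/∂u1 = (v3^5/v2^4) α1; ∂v1/∂u2 = (v1^5/v3^4) α2, ∂v2/∂u2 = (v2/v3^4)(v1^4 - v1^2 v3^2 + v3^4) α2, ∂v3/∂u2 = v3 α2; ∂v1/∂u3 = v1 α3, ∂v2/∂u3 = (v2^5/v1^4) α3, ∂v3/∂u3 = (v3/v1^4)(v1^4 + v1^2 v2^2 + v2^4) α3; ∂α2/∂u1 = 2(v1^2/v2^2) α1 α2, ∂α3/∂u1 = 2(v3^2/v2^4)(4 v3^2 + v1^2) α1 α3; ∂α1/∂u2 = 2(v1^2/v3^4)(4 v1^2 - v2^2) α1 α2, ∂α3/∂u2 = 2(v2^2/v3^2)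 α2 α3; ∂α1/∂u3 = -2(v3^2/v1^2) α1 α3, ∂α2/∂u3 = 2(v2^2/v1^4)(4 v2^2 - v3^2) α2 α3; ∂α1/∂u1 = (1/v2^4)(3 v2^4 - v3^4) α1^2 - (v1^6/v3^8)(3 v1^2 - 2 v3^2) α2^2 + (v2^4/(v1^2 v3^4))(3 v1^2 + 2 v2^2) α3^2 + (1/(9 v3^4))(5 v1^4 + 2 v2^2 v3^2) - (v1^2 v2^2 / v3^2) c + (v1 v2/(18 v3^3))(v2^2 + v3^2 - 2 v1 v2 v3 H) H; ∂α2/∂u2 = -(v3^4/(v1^4 v2^2))(3 v2^2 + 2 v3^2) α1^2 - (1/v3^4)(v1^4 - 3 v3^4) α2^2 - (v2^6/v1^8)(2 v1^2 + 3 v2^2) α3^2 - (1/(9 v1^4))(5 v2^4 - 2 v1^2 v3^2) + (v2^2 v3^2 / v1^2) c - (v2 v3/(18 v1^3))(v1^2 - v3^2 - 2 v1 v2 v3 H) H; ∂α3/∂u3 = (v3^6/v2^8)(2 v2^2 + 3 v3^2) α1^2 + (v1^4/(v2^4 v3^2))(2 v1^2 - 3 v3^2) α2^2 + (1/v1^4)(3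 v1^4 - v2^4) α3^2 + (1/(9 v2^4))(5 v3^4 + 2 v1^2 v2^2) - (v1^2 v3^2 / v2^2) c - (v1 v3/(18 v2^3))(v1^2 + v2^2 + 2 v1 v2 v3 H) H. -/
noncomputable section

/-- Partial derivative of `f : ℝ³ → ℝ` in the `i`-th coordinate direction `u_{i+1}`. -/
noncomputable def pd (i : Fin 3) (f : (Fin 3 → ℝ) → ℝ) (p : Fin 3 → ℝ) : ℝ :=
  fderiv ℝ f p (Pi.single i 1)

/-- `hh v i j p = h_{ij}(p) = (1/v_i) ∂v_j/∂u_i` (indices shifted down by one: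
`v 0, v 1, v 2` are `v₁, v₂, v₃` and directions `0,1,2` are `u₁,u₂,u₃`). -/
noncomputable def hh (v : Fin 3 → (Fin 3 → ℝ) → ℝ) (i j : Fin 3) (p : Fin 3 → ℝ) : ℝ :=
  (1 / v i p) * pd i (v j) p

/-- `al v 0 = α₁ = (1/v₂)∂v₂/∂u₁`, `al v 1 = α₂ = (1/v₃)∂v₃/∂u₂`,
`al v 2 = α₃ = (1/v₁)∂v₁/∂u₃`. -/
noncomputable def al (v : Fin 3 → (Fin 3 → ℝ) → ℝ) (i : Fin 3) (p : Fin 3 → ℝ) : ℝ :=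
  (1 / v (i + 1) p) * pd i (v (i + 1)) p

/-- The holonomic system hypotheses together with the conformally flat
constant-mean-curvature ansatz, on a connected open set `U ⊆ ℝ³`. -/
structure Hypo (U : Set (Fin 3 → ℝ)) (v V : Fin 3 → (Fin 3 → ℝ) → ℝ) (c H : ℝ) : Prop where
  hopen : IsOpen U
  hconn : IsConnected U
  smooth_v : ∀ i, ContDiffOn ℝ (⊤ : ℕ∞) (v i) U
  smooth_V : ∀ i, ContDiffOn ℝ (⊤ : ℕ∞) (V i) U
  pos : ∀ i, ∀ p ∈ U, 0 < v i p
  holi : ∀ i j, i ≠ j → ∀ p ∈ U, pd j (v i) p = hh v j i p * v j p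
  holii : ∀ i j k, i ≠ j → j ≠ k → i ≠ k → ∀ p ∈ U,
    pd j (hh v i k) p = hh v i j p * hh v j k p
  holiii : ∀ i j k, i ≠ j → j ≠ k → i ≠ k → ∀ p ∈ U,
    pd i (hh v i j) p + pd j (hh v j i) p + hh v k i p * hh v k j p
      + V i p * V j p + c * v i p * v j p = 0
  holiv : ∀ i j, i ≠ j → ∀ p ∈ U, pd j (V i) p = hh v j i p * V j p
  ansatz_v : ∀ p ∈ U, (v 1 p) ^ 2 = (v 0 p) ^ 2 + (v 2 p) ^ 2
  ansatz_V1 : ∀ p ∈ U, V 0 p = -(1/3) * (v 1 p / v 2 p + v 2 p / v 1 p) + (v 0 p / 3) * H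
  ansatz_V2 : ∀ p ∈ U, V 1 p = -(1/3) * (v 0 p / v 2 p - v 2 p / v 0 p) + (v 1 p / 3) * H
  ansatz_V3 : ∀ p ∈ U, V 2 p = (1/3) * (v 0 p / v 1 p + v 1 p / v 0 p) + (v 2 p / 3) * H

section PartialDerivatives

variable {U : Set (Fin 3 → ℝ)} {f g k h α : (Fin 3 → ℝ) → ℝ} {p : Fin 3 → ℝ}

theorem pd_congr (hU : IsOpen U) (hp : p ∈ U) (hfg : ∀ q ∈ U, f q = g q) (i : Fin 3) :
    pd i f p = pd i g p := by
  have : f =ᶠ[nhds p] g := Filter.eventuallyEq_of_mem (hU.mem_nhds hp) hfg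
  rw [pd, pd, this.fderiv_eq]

theorem pd_add (hf : DifferentiableAt ℝ f p) (hg : DifferentiableAt ℝ g p) (i : Fin 3) :
    pd i (fun q => f q + g q) p = pd i f p + pd i g p := by
  simp [pd, fderiv_fun_add hf hg]

theorem pd_sub (hf : DifferentiableAt ℝ f p) (hg : DifferentiableAt ℝ g p) (i : Fin 3) :
    pd i (fun q => f q - g q) p = pd i f p - pd i g p := by
  simp [pd, fderiv_fun_sub hf hg]

theorem pd_mul (hf : DifferentiableAt ℝ f p) (hg : DifferentiableAt ℝ g p) (i : Fin 3) :
    pd i (fun q => f q * g q) p = pd i f p * g p + f p * pd i g p := by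
  simp [pd, fderiv_fun_mul hf hg]
  ring

theorem pd_mul_const (hf : DifferentiableAt ℝ f p) (r : ℝ) (i : Fin 3) :
    pd i (fun q => f q * r) p = pd i f p * r := by
  rw [pd, fderiv_mul_const hf, pd]
  simp [mul_comm]

theorem pd_pow (hf : DifferentiableAt ℝ f p) (n : ℕ) (i : Fin 3) :
    pd i (fun q => f q ^ n) p = n * f p ^ (n - 1) * pd i f p := by
  simp [pd, fderiv_fun_pow n hf]

theorem pd_mul_eq_mul (hU : IsOpen U) (hp : p ∈ U) (dh : DifferentiableAt ℝ h p)
    (hf : DifferentiableAt ℝ f p) (hg : DifferentiableAt ℝ g p) (hα : DifferentiableAt ℝ α p)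
    (heq : ∀ q ∈ U, h q * f q = g q * α q) (i : Fin 3) :
    pd i h p * f p + h p * pd i f p = pd i g p * α p + g p * pd i α p := by
  rw [← pd_mul dh hf, ← pd_mul hg hα]
  exact pd_congr hU hp heq i

theorem pd_mul_pow_eq_pow_mul (hU : IsOpen U) (hp : p ∈ U) (dh : DifferentiableAt ℝ h p)
    (hf : DifferentiableAt ℝ f p) (hg : DifferentiableAt ℝ g p) (hk : DifferentiableAt ℝ k p)
    (hα : DifferentiableAt ℝ α p)
    (heq : ∀ q ∈ U, h q * (f q ^ 4 * g q) = k q ^ 5 * α q) (i : Fin 3) :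
    pd i h p * (f p ^ 4 * g p) + h p * (4 * f p ^ 3 * pd i f p * g p + f p ^ 4 * pd i g p)
      = 5 * k p ^ 4 * pd i k p * α p + k p ^ 5 * pd i α p := by
  have key := pd_mul_eq_mul hU hp dh ((hf.fun_pow 4).fun_mul hg) (hk.fun_pow 5) hα heq i
  rw [pd_mul (hf.fun_pow 4) hg, pd_pow hf, pd_pow hk] at key
  simpa using key

end PartialDerivatives

theorem solve_gauss_system {a b d X Y Z E₁ E₂ E₃ : ℝ} (ha : a ≠ 0) (hb : b ≠ 0) (hd : d ≠ 0)
    (h₁ : b / a * X + a ^ 5 / (d ^ 4 * b) * Y = E₁)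
    (h₂ : d ^ 5 / (b ^ 4 * a) * X + a / d * Z = E₂)
    (h₃ : d / b * Y + b ^ 5 / (a ^ 4 * d) * Z = E₃) :
    X = (a / b * E₁ + a * b ^ 4 / d ^ 5 * E₂ - a ^ 6 / (d ^ 5 * b) * E₃) / 2 ∧
      Y = (d ^ 4 * b / a ^ 5 * E₁ - b ^ 6 / (a ^ 5 * d) * E₂ + b / d * E₃) / 2 ∧
      Z = (-(d ^ 6 / (b ^ 5 * a)) * E₁ + d / a * E₂ + d * a ^ 4 / b ^ 5 * E₃) / 2 := by
  subst h₁ h₂ h₃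
  refine ⟨?_, ?_, ?_⟩ <;> field_simp <;> ring

namespace Hypo

variable {U : Set (Fin 3 → ℝ)} {v V : Fin 3 → (Fin 3 → ℝ) → ℝ} {c H : ℝ} {p : Fin 3 → ℝ}

theorem v_ne_zero (hyp : Hypo U v V c H) (hp : p ∈ U) : v 0 p ≠ 0 ∧ v 1 p ≠ 0 ∧ v 2 p ≠ 0 :=
  ⟨(hyp.pos 0 p hp).ne', (hyp.pos 1 p hp).ne', (hyp.pos 2 p hp).ne'⟩

theorem differentiableAt_v (hyp : Hypo U v V c H) (hp : p ∈ U) (i : Fin 3) :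
    DifferentiableAt ℝ (v i) p :=
  ((hyp.smooth_v i).contDiffAt (hyp.hopen.mem_nhds hp)).differentiableAt (by simp)

theorem differentiableAt_V (hyp : Hypo U v V c H) (hp : p ∈ U) (i : Fin 3) :
    DifferentiableAt ℝ (V i) p :=
  ((hyp.smooth_V i).contDiffAt (hyp.hopen.mem_nhds hp)).differentiableAt (by simp)

theorem differentiableAt_hh (hyp : Hypo U v V c H) (hp : p ∈ U) (i j : Fin 3) :
    DifferentiableAt ℝ (hh v i j) p := by
  have hfd : DifferentiableAt ℝ (fderiv ℝ (v j)) p :=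
    (((hyp.smooth_v j).contDiffAt (hyp.hopen.mem_nhds hp)).fderiv_right
      (m := 1) (by norm_cast)).differentiableAt (by simp)
  have hpd : DifferentiableAt ℝ (pd i (v j)) p := hfd.clm_apply (differentiableAt_const _)
  have hv := hyp.differentiableAt_v hp i
  have hv_ne := (hyp.pos i p hp).ne'
  unfold hh
  fun_prop (disch := assumption)

theorem pd_v_eq_hh (hyp : Hypo U v V c H) (hp : p ∈ U) (i j : Fin 3) :
    pd i (v j) p = v i p * hh v i j p := by
  have := (hyp.pos i p hp).ne'
  rw [hh]
  field_simp

theorem pd_v_succ (hyp : Hypo U v V c H) (hp : p ∈ U) (i : Fin 3) :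
    pd i (v (i + 1)) p = v (i + 1) p * al v i p := by
  have := (hyp.pos (i + 1) p hp).ne'
  rw [al]
  field_simp

theorem differentiableAt_al (hyp : Hypo U v V c H) (hp : p ∈ U) (i : Fin 3) :
    DifferentiableAt ℝ (al v i) p := by
  have hv := hyp.differentiableAt_v hp (i + 1)
  have heq : al v i =ᶠ[nhds p] fun q => 1 / v (i + 1) q * (v i q * hh v i (i + 1) q) :=
    Filter.eventuallyEq_of_mem (hyp.hopen.mem_nhds hp) fun q hq => by
      rw [al, hyp.pd_v_eq_hh hq]
  have hv_ne := (hyp.pos (i + 1) p hp).ne'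
  have hvi := hyp.differentiableAt_v hp i
  have hhi := hyp.differentiableAt_hh hp i (i + 1)
  refine DifferentiableAt.congr_of_eventuallyEq ?_ heq
  fun_prop (disch := assumption)

theorem pd_ansatz_v (hyp : Hypo U v V c H) (hp : p ∈ U) (i : Fin 3) :
    v 1 p * pd i (v 1) p = v 0 p * pd i (v 0) p + v 2 p * pd i (v 2) p := by
  have hv := hyp.differentiableAt_v hp
  have key := pd_congr hyp.hopen hp hyp.ansatz_v i
  rw [pd_add ((hv 0).fun_pow 2) ((hv 2).fun_pow 2), pd_pow (hv 0), pd_pow (hv 1),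
    pd_pow (hv 2)] at key
  norm_num at key
  linarith

theorem pd_ansatz_V1 (hyp : Hypo U v V c H) (hp : p ∈ U) (i : Fin 3) :
    pd i (V 0) p * (v 1 p * v 2 p) + V 0 p * (pd i (v 1) p * v 2 p + v 1 p * pd i (v 2) p)
      = -(2 / 3) * (v 1 p * pd i (v 1) p + v 2 p * pd i (v 2) p)
        + (pd i (v 0) p * v 1 p * v 2 p + v 0 p * pd i (v 1) p * v 2 p
          + v 0 p * v 1 p * pd i (v 2) p) * (H / 3) := by
  have hv := hyp.differentiableAt_v hp
  have heq : ∀ q ∈ U, V 0 q * (v 1 q * v 2 q)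
      = (v 1 q ^ 2 + v 2 q ^ 2) * (-1 / 3) + v 0 q * (v 1 q * v 2 q) * (H / 3) := fun q hq => by
    have h1 := (hyp.pos 1 q hq).ne'
    have h2 := (hyp.pos 2 q hq).ne'
    rw [hyp.ansatz_V1 q hq]
    field_simp
  have key := pd_congr hyp.hopen hp heq i
  rw [pd_mul (hyp.differentiableAt_V hp 0) ((hv 1).fun_mul (hv 2)), pd_mul (hv 1) (hv 2),
    pd_add (by fun_prop) (by fun_prop), pd_mul_const (by fun_prop), pd_mul_const (by fun_prop),
    pd_mul (by fun_prop) (by fun_prop), pd_mul (hv 1) (hv 2), pd_add (by fun_prop) (by fun_prop),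
    pd_pow (hv 1), pd_pow (hv 2)] at key
  norm_num at key
  linear_combination key

theorem pd_ansatz_V2 (hyp : Hypo U v V c H) (hp : p ∈ U) (i : Fin 3) :
    pd i (V 1) p * (v 0 p * v 2 p) + V 1 p * (pd i (v 0) p * v 2 p + v 0 p * pd i (v 2) p)
      = -(2 / 3) * (v 0 p * pd i (v 0) p - v 2 p * pd i (v 2) p)
        + (pd i (v 1) p * v 0 p * v 2 p + v 1 p * pd i (v 0) p * v 2 p
          + v 1 p * v 0 p * pd i (v 2) p) * (H / 3) := by
  have hv := hyp.differentiableAt_v hp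
  have heq : ∀ q ∈ U, V 1 q * (v 0 q * v 2 q)
      = (v 0 q ^ 2 - v 2 q ^ 2) * (-1 / 3) + v 1 q * (v 0 q * v 2 q) * (H / 3) := fun q hq => by
    have h0 := (hyp.pos 0 q hq).ne'
    have h2 := (hyp.pos 2 q hq).ne'
    rw [hyp.ansatz_V2 q hq]
    field_simp
  have key := pd_congr hyp.hopen hp heq i
  rw [pd_mul (hyp.differentiableAt_V hp 1) ((hv 0).fun_mul (hv 2)), pd_mul (hv 0) (hv 2),
    pd_add (by fun_prop) (by fun_prop), pd_mul_const (by fun_prop), pd_mul_const (by fun_prop),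
    pd_mul (by fun_prop) (by fun_prop), pd_mul (hv 0) (hv 2), pd_sub (by fun_prop) (by fun_prop),
    pd_pow (hv 0), pd_pow (hv 2)] at key
  norm_num at key
  linear_combination key

theorem pd_zero_v (hyp : Hypo U v V c H) (hp : p ∈ U) :
    pd 0 (v 0) p = (v 0 p / (v 1 p) ^ 4)
        * ((v 1 p) ^ 4 + (v 1 p) ^ 2 * (v 2 p) ^ 2 + (v 2 p) ^ 4) * al v 0 p ∧
      pd 0 (v 1) p = v 1 p * al v 0 p ∧
      pd 0 (v 2) p = ((v 2 p) ^ 5 / (v 1 p) ^ 4) * al v 0 p := by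
  obtain ⟨h0, h1, h2⟩ := hyp.v_ne_zero hp
  have hb := hyp.ansatz_v p hp
  have hx : pd 0 (v 1) p = v 1 p * al v 0 p := hyp.pd_v_succ hp 0
  have L1 := hyp.pd_ansatz_v hp 0
  have L2 := hyp.pd_ansatz_V2 hp 0
  rw [hyp.holiv 1 0 (by decide) p hp, hyp.ansatz_V1 p hp, hyp.ansatz_V2 p hp, hh, hx] at L2
  rw [hx] at L1
  generalize v 0 p = a at *
  generalize v 1 p = b at *
  generalize v 2 p = d at *
  generalize al v 0 p = x at *
  generalize pd 0 (v 0) p = a' at *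
  generalize pd 0 (v 2) p = d' at *
  have L3 : b ^ 2 * (d * a' - a * d') = (b ^ 2 + d ^ 2) * a * d * x := by
    field_simp at L2
    linear_combination L2 + (d * a' - a * d') * hb
  have hd : d' = d ^ 5 / b ^ 4 * x := by
    field_simp
    linear_combination -a * L3 - b ^ 2 * d * L1 + (b ^ 2 * d' + x * d * (b ^ 2 + d ^ 2)) * hb
  refine ⟨?_, hx, hd⟩
  · field_simp
    linear_combination d * L3 - b ^ 2 * a * L1 + b ^ 2 * a' * hb

theorem pd_one_v (hyp : Hypo U v V c H) (hp : p ∈ U) :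
    pd 1 (v 0) p = ((v 0 p) ^ 5 / (v 2 p) ^ 4) * al v 1 p ∧
      pd 1 (v 1) p = (v 1 p / (v 2 p) ^ 4)
        * ((v 0 p) ^ 4 - (v 0 p) ^ 2 * (v 2 p) ^ 2 + (v 2 p) ^ 4) * al v 1 p ∧
      pd 1 (v 2) p = v 2 p * al v 1 p := by
  obtain ⟨h0, h1, h2⟩ := hyp.v_ne_zero hp
  have hb := hyp.ansatz_v p hp
  have hy : pd 1 (v 2) p = v 2 p * al v 1 p := hyp.pd_v_succ hp 1
  have L1 := hyp.pd_ansatz_v hp 1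
  have L2 := hyp.pd_ansatz_V1 hp 1
  rw [hyp.holiv 0 1 (by decide) p hp, hyp.ansatz_V1 p hp, hyp.ansatz_V2 p hp, hh, hy] at L2
  rw [hy] at L1
  generalize v 0 p = a at *
  generalize v 1 p = b at *
  generalize v 2 p = d at *
  generalize al v 1 p = y at *
  generalize pd 1 (v 0) p = a' at *
  generalize pd 1 (v 1) p = b' at *
  have L3 : a ^ 3 * (b' - b * y) = b * (a ^ 2 - d ^ 2) * a' := by
    field_simp at L2
    linear_combination L2 - a * (b' - b * y) * hb
  have hap : a' * d ^ 4 = a ^ 5 * y := by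
    linear_combination b * L3 - a ^ 3 * L1 + (a' * (a ^ 2 - d ^ 2) + a ^ 3 * y) * hb
  have ha : a' = a ^ 5 / d ^ 4 * y := by
    field_simp
    exact hap
  refine ⟨ha, ?_, hy⟩
  · field_simp
    apply mul_left_cancel₀ h1
    linear_combination d ^ 4 * L1 + a * hap - y * (a ^ 4 - a ^ 2 * d ^ 2 + d ^ 4) * hb

theorem pd_two_v (hyp : Hypo U v V c H) (hp : p ∈ U) :
    pd 2 (v 0) p = v 0 p * al v 2 p ∧
      pd 2 (v 1) p = ((v 1 p) ^ 5 / (v 0 p) ^ 4) * al v 2 p ∧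
      pd 2 (v 2) p = (v 2 p / (v 0 p) ^ 4)
        * ((v 0 p) ^ 4 + (v 0 p) ^ 2 * (v 1 p) ^ 2 + (v 1 p) ^ 4) * al v 2 p := by
  obtain ⟨h0, h1, h2⟩ := hyp.v_ne_zero hp
  have hb := hyp.ansatz_v p hp
  have hz : pd 2 (v 0) p = v 0 p * al v 2 p := hyp.pd_v_succ hp 2
  have L1 := hyp.pd_ansatz_v hp 2
  have L2 := hyp.pd_ansatz_V1 hp 2
  rw [hyp.holiv 0 2 (by decide) p hp, hyp.ansatz_V1 p hp, hyp.ansatz_V3 p hp, hh, hz] at L2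
  rw [hz] at L1
  generalize v 0 p = a at *
  generalize v 1 p = b at *
  generalize v 2 p = d at *
  generalize al v 2 p = z at *
  generalize pd 2 (v 1) p = b' at *
  generalize pd 2 (v 2) p = d' at *
  have L3 : a ^ 2 * (d * b' - b * d') = - b * d * (a ^ 2 + b ^ 2) * z := by
    field_simp at L2
    linear_combination L2 - (d * b' - b * d') * hb
  have hdp : d' * a ^ 4 = d * (a ^ 4 + a ^ 2 * b ^ 2 + b ^ 4) * z := by
    linear_combination -b * L3 + a ^ 2 * d * L1 - a ^ 2 * d' * hb
  have hd : d' = d / a ^ 4 * (a ^ 4 + a ^ 2 * b ^ 2 + b ^ 4) * z := by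
    field_simp
    linear_combination hdp
  refine ⟨hz, ?_, hd⟩
  · field_simp
    apply mul_left_cancel₀ h1
    linear_combination a ^ 4 * L1 + d * hdp - z * (a ^ 4 + a ^ 2 * b ^ 2 + b ^ 4) * hb

theorem hh_mul_eq (hyp : Hypo U v V c H) (hp : p ∈ U) (i : Fin 3) :
    hh v i (i + 1) p * v i p = v (i + 1) p * al v i p := by
  have := (hyp.pos i p hp).ne'
  rw [hh, hyp.pd_v_succ hp]
  field_simp

theorem hh_zero_two (hyp : Hypo U v V c H) (hp : p ∈ U) :
    hh v 0 2 p * (v 1 p ^ 4 * v 0 p) = v 2 p ^ 5 * al v 0 p := by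
  have h0 := (hyp.pos 0 p hp).ne'
  have h1 := (hyp.pos 1 p hp).ne'
  rw [hh, (hyp.pd_zero_v hp).2.2]
  field_simp

theorem hh_one_zero (hyp : Hypo U v V c H) (hp : p ∈ U) :
    hh v 1 0 p * (v 2 p ^ 4 * v 1 p) = v 0 p ^ 5 * al v 1 p := by
  have h1 := (hyp.pos 1 p hp).ne'
  have h2 := (hyp.pos 2 p hp).ne'
  rw [hh, (hyp.pd_one_v hp).1]
  field_simp

theorem hh_two_one (hyp : Hypo U v V c H) (hp : p ∈ U) :
    hh v 2 1 p * (v 0 p ^ 4 * v 2 p) = v 1 p ^ 5 * al v 2 p := by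
  have h0 := (hyp.pos 0 p hp).ne'
  have h2 := (hyp.pos 2 p hp).ne'
  rw [hh, (hyp.pd_two_v hp).2.1]
  field_simp

theorem pd_hh_succ (hyp : Hypo U v V c H) (hp : p ∈ U) (i j : Fin 3) :
    pd j (hh v i (i + 1)) p * v i p + hh v i (i + 1) p * pd j (v i) p
      = pd j (v (i + 1)) p * al v i p + v (i + 1) p * pd j (al v i) p :=
  pd_mul_eq_mul hyp.hopen hp (hyp.differentiableAt_hh hp _ _) (hyp.differentiableAt_v hp _)
    (hyp.differentiableAt_v hp _) (hyp.differentiableAt_al hp _)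
    (fun _ hq => hyp.hh_mul_eq hq i) j

theorem pd_hh_zero_two (hyp : Hypo U v V c H) (hp : p ∈ U) (i : Fin 3) :
    pd i (hh v 0 2) p * (v 1 p ^ 4 * v 0 p)
        + hh v 0 2 p * (4 * v 1 p ^ 3 * pd i (v 1) p * v 0 p + v 1 p ^ 4 * pd i (v 0) p)
      = 5 * v 2 p ^ 4 * pd i (v 2) p * al v 0 p + v 2 p ^ 5 * pd i (al v 0) p :=
  pd_mul_pow_eq_pow_mul hyp.hopen hp (hyp.differentiableAt_hh hp _ _) (hyp.differentiableAt_v hp _)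
    (hyp.differentiableAt_v hp _) (hyp.differentiableAt_v hp _) (hyp.differentiableAt_al hp _)
    (fun _ hq => hyp.hh_zero_two hq) i

theorem pd_hh_one_zero (hyp : Hypo U v V c H) (hp : p ∈ U) (i : Fin 3) :
    pd i (hh v 1 0) p * (v 2 p ^ 4 * v 1 p)
        + hh v 1 0 p * (4 * v 2 p ^ 3 * pd i (v 2) p * v 1 p + v 2 p ^ 4 * pd i (v 1) p)
      = 5 * v 0 p ^ 4 * pd i (v 0) p * al v 1 p + v 0 p ^ 5 * pd i (al v 1) p :=
  pd_mul_pow_eq_pow_mul hyp.hopen hp (hyp.differentiableAt_hh hp _ _) (hyp.differentiableAt_v hp _)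
    (hyp.differentiableAt_v hp _) (hyp.differentiableAt_v hp _) (hyp.differentiableAt_al hp _)
    (fun _ hq => hyp.hh_one_zero hq) i

theorem pd_hh_two_one (hyp : Hypo U v V c H) (hp : p ∈ U) (i : Fin 3) :
    pd i (hh v 2 1) p * (v 0 p ^ 4 * v 2 p)
        + hh v 2 1 p * (4 * v 0 p ^ 3 * pd i (v 0) p * v 2 p + v 0 p ^ 4 * pd i (v 2) p)
      = 5 * v 1 p ^ 4 * pd i (v 1) p * al v 2 p + v 1 p ^ 5 * pd i (al v 2) p :=
  pd_mul_pow_eq_pow_mul hyp.hopen hp (hyp.differentiableAt_hh hp _ _) (hyp.differentiableAt_v hp _)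
    (hyp.differentiableAt_v hp _) (hyp.differentiableAt_v hp _) (hyp.differentiableAt_al hp _)
    (fun _ hq => hyp.hh_two_one hq) i

theorem pd_zero_al_one (hyp : Hypo U v V c H) (hp : p ∈ U) :
    pd 0 (al v 1) p = 2 * ((v 0 p) ^ 2 / (v 1 p) ^ 2) * al v 0 p * al v 1 p := by
  obtain ⟨h0, h1, h2⟩ := hyp.v_ne_zero hp
  have hb := hyp.ansatz_v p hp
  obtain ⟨e0, e1, e2⟩ := hyp.pd_zero_v hp
  obtain ⟨f0, f1, f2⟩ := hyp.pd_one_v hp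
  have key : pd 0 (hh v 1 2) p * v 1 p + hh v 1 2 p * pd 0 (v 1) p
      = pd 0 (v 2) p * al v 1 p + v 2 p * pd 0 (al v 1) p := hyp.pd_hh_succ hp 1 0
  rw [hyp.holii 1 0 2 (by decide) (by decide) (by decide) p hp] at key
  simp only [hh, e1, e2, f0, f2] at key
  clear e0 e1 e2 f0 f1 f2 hyp
  field_simp at key ⊢
  grind

theorem pd_zero_al_two (hyp : Hypo U v V c H) (hp : p ∈ U) :
    pd 0 (al v 2) p = 2 * ((v 2 p) ^ 2 / (v 1 p) ^ 4) * (4 * (v 2 p) ^ 2 + (v 0 p) ^ 2)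
        * al v 0 p * al v 2 p := by
  obtain ⟨h0, h1, h2⟩ := hyp.v_ne_zero hp
  have hb := hyp.ansatz_v p hp
  obtain ⟨e0, e1, e2⟩ := hyp.pd_zero_v hp
  obtain ⟨f0, f1, f2⟩ := hyp.pd_two_v hp
  have key := hyp.pd_hh_two_one hp 0
  rw [hyp.holii 2 0 1 (by decide) (by decide) (by decide) p hp] at key
  simp only [hh, e0, e1, e2, f0, f1] at key
  clear e0 e1 e2 f0 f1 f2 hyp
  field_simp at key ⊢
  grind

theorem pd_one_al_zero (hyp : Hypo U v V c H) (hp : p ∈ U) :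
    pd 1 (al v 0) p = 2 * ((v 0 p) ^ 2 / (v 2 p) ^ 4) * (4 * (v 0 p) ^ 2 - (v 1 p) ^ 2)
        * al v 0 p * al v 1 p := by
  obtain ⟨h0, h1, h2⟩ := hyp.v_ne_zero hp
  have hb := hyp.ansatz_v p hp
  obtain ⟨e0, e1, e2⟩ := hyp.pd_one_v hp
  obtain ⟨f0, f1, f2⟩ := hyp.pd_zero_v hp
  have key := hyp.pd_hh_zero_two hp 1
  rw [hyp.holii 0 1 2 (by decide) (by decide) (by decide) p hp] at key
  simp only [hh, e0, e1, e2, f1, f2] at key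
  clear e0 e1 e2 f0 f1 f2 hyp
  field_simp at key ⊢
  grind

theorem pd_one_al_two (hyp : Hypo U v V c H) (hp : p ∈ U) :
    pd 1 (al v 2) p = 2 * ((v 1 p) ^ 2 / (v 2 p) ^ 2) * al v 1 p * al v 2 p := by
  obtain ⟨h0, h1, h2⟩ := hyp.v_ne_zero hp
  have hb := hyp.ansatz_v p hp
  obtain ⟨e0, e1, e2⟩ := hyp.pd_one_v hp
  obtain ⟨f0, f1, f2⟩ := hyp.pd_two_v hp
  have key : pd 1 (hh v 2 0) p * v 2 p + hh v 2 0 p * pd 1 (v 2) p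
      = pd 1 (v 0) p * al v 2 p + v 0 p * pd 1 (al v 2) p := hyp.pd_hh_succ hp 2 1
  rw [hyp.holii 2 1 0 (by decide) (by decide) (by decide) p hp] at key
  simp only [hh, e0, e2, f0, f1] at key
  clear e0 e1 e2 f0 f1 f2 hyp
  field_simp at key ⊢
  grind

theorem pd_two_al_zero (hyp : Hypo U v V c H) (hp : p ∈ U) :
    pd 2 (al v 0) p = -2 * ((v 2 p) ^ 2 / (v 0 p) ^ 2) * al v 0 p * al v 2 p := by
  obtain ⟨h0, h1, h2⟩ := hyp.v_ne_zero hp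
  have hb := hyp.ansatz_v p hp
  obtain ⟨e0, e1, e2⟩ := hyp.pd_two_v hp
  obtain ⟨f0, f1, f2⟩ := hyp.pd_zero_v hp
  have key : pd 2 (hh v 0 1) p * v 0 p + hh v 0 1 p * pd 2 (v 0) p
      = pd 2 (v 1) p * al v 0 p + v 1 p * pd 2 (al v 0) p := hyp.pd_hh_succ hp 0 2
  rw [hyp.holii 0 2 1 (by decide) (by decide) (by decide) p hp] at key
  simp only [hh, e0, e1, f1, f2] at key
  clear e0 e1 e2 f0 f1 f2 hyp
  field_simp at key ⊢
  grind

theorem pd_two_al_one (hyp : Hypo U v V c H) (hp : p ∈ U) :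
    pd 2 (al v 1) p = 2 * ((v 1 p) ^ 2 / (v 0 p) ^ 4) * (4 * (v 1 p) ^ 2 - (v 2 p) ^ 2)
        * al v 1 p * al v 2 p := by
  obtain ⟨h0, h1, h2⟩ := hyp.v_ne_zero hp
  have hb := hyp.ansatz_v p hp
  obtain ⟨e0, e1, e2⟩ := hyp.pd_two_v hp
  obtain ⟨f0, f1, f2⟩ := hyp.pd_one_v hp
  have key := hyp.pd_hh_one_zero hp 2
  rw [hyp.holii 1 2 0 (by decide) (by decide) (by decide) p hp] at key
  simp only [hh, e0, e1, e2, f0, f2] at key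
  clear e0 e1 e2 f0 f1 f2 hyp
  field_simp at key ⊢
  grind

theorem gauss_zero_one (hyp : Hypo U v V c H) (hp : p ∈ U) :
    v 1 p / v 0 p * pd 0 (al v 0) p + v 0 p ^ 5 / (v 2 p ^ 4 * v 1 p) * pd 1 (al v 1) p
      = v 2 p ^ 2 * (v 1 p ^ 2 + v 2 p ^ 2) / (v 0 p * v 1 p ^ 3) * al v 0 p ^ 2
        - v 0 p ^ 5 * (4 * v 0 p ^ 2 + 5 * v 2 p ^ 2) * (v 0 p ^ 2 - v 2 p ^ 2)
          / (v 2 p ^ 8 * v 1 p) * al v 1 p ^ 2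
        - v 1 p ^ 5 / (v 0 p ^ 3 * v 2 p ^ 2) * al v 2 p ^ 2
        - V 0 p * V 1 p - c * v 0 p * v 1 p := by
  obtain ⟨h0, h1, h2⟩ := hyp.v_ne_zero hp
  obtain ⟨e0, e1, e2⟩ := hyp.pd_zero_v hp
  obtain ⟨f0, f1, f2⟩ := hyp.pd_one_v hp
  obtain ⟨g0, g1, g2⟩ := hyp.pd_two_v hp
  have key1 : pd 0 (hh v 0 1) p * v 0 p + hh v 0 1 p * pd 0 (v 0) p
      = pd 0 (v 1) p * al v 0 p + v 1 p * pd 0 (al v 0) p := hyp.pd_hh_succ hp 0 0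
  have key2 := hyp.pd_hh_one_zero hp 1
  have key := hyp.holiii 0 1 2 (by decide) (by decide) (by decide) p hp
  generalize hP : pd 0 (hh v 0 1) p = P at *
  generalize hQ : pd 1 (hh v 1 0) p = Q at *
  simp only [hh, e0, e1, f0, f1, f2, g0, g1] at key key1 key2
  clear hP hQ e0 e1 e2 f0 f1 f2 g0 g1 g2 hyp
  linear_combination (norm := (field_simp; ring)) key - key1 / v 0 p - key2 / (v 2 p ^ 4 * v 1 p)

theorem gauss_zero_two (hyp : Hypo U v V c H) (hp : p ∈ U) :
    v 2 p ^ 5 / (v 1 p ^ 4 * v 0 p) * pd 0 (al v 0) p + v 0 p / v 2 p * pd 2 (al v 2) p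
      = v 2 p ^ 5 * (5 * v 1 p ^ 4 + v 1 p ^ 2 * v 2 p ^ 2 - 4 * v 2 p ^ 4)
          / (v 1 p ^ 8 * v 0 p) * al v 0 p ^ 2
        - v 0 p ^ 5 / (v 2 p ^ 3 * v 1 p ^ 2) * al v 1 p ^ 2
        + v 1 p ^ 2 * (v 0 p ^ 2 + v 1 p ^ 2) / (v 0 p ^ 3 * v 2 p) * al v 2 p ^ 2
        - V 0 p * V 2 p - c * v 0 p * v 2 p := by
  obtain ⟨h0, h1, h2⟩ := hyp.v_ne_zero hp
  obtain ⟨e0, e1, e2⟩ := hyp.pd_zero_v hp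
  obtain ⟨f0, f1, f2⟩ := hyp.pd_one_v hp
  obtain ⟨g0, g1, g2⟩ := hyp.pd_two_v hp
  have key1 := hyp.pd_hh_zero_two hp 0
  have key2 : pd 2 (hh v 2 0) p * v 2 p + hh v 2 0 p * pd 2 (v 2) p
      = pd 2 (v 0) p * al v 2 p + v 0 p * pd 2 (al v 2) p := hyp.pd_hh_succ hp 2 2
  have key := hyp.holiii 0 2 1 (by decide) (by decide) (by decide) p hp
  generalize hP : pd 0 (hh v 0 2) p = P at *
  generalize hQ : pd 2 (hh v 2 0) p = Q at *
  simp only [hh, e0, e1, e2, f0, f2, g0, g2] at key key1 key2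
  clear hP hQ e0 e1 e2 f0 f1 f2 g0 g1 g2 hyp
  linear_combination (norm := (field_simp; ring)) key - key1 / (v 1 p ^ 4 * v 0 p) - key2 / v 2 p

theorem gauss_one_two (hyp : Hypo U v V c H) (hp : p ∈ U) :
    v 2 p / v 1 p * pd 1 (al v 1) p + v 1 p ^ 5 / (v 0 p ^ 4 * v 2 p) * pd 2 (al v 2) p
      = -(v 2 p ^ 5 / (v 0 p ^ 2 * v 1 p ^ 3)) * al v 0 p ^ 2
        + v 0 p ^ 2 * (v 0 p ^ 2 - v 2 p ^ 2) / (v 1 p * v 2 p ^ 3) * al v 1 p ^ 2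
        - v 1 p ^ 5 * (4 * v 1 p ^ 4 - v 0 p ^ 2 * v 1 p ^ 2 - 5 * v 0 p ^ 4)
          / (v 0 p ^ 8 * v 2 p) * al v 2 p ^ 2
        - V 1 p * V 2 p - c * v 1 p * v 2 p := by
  obtain ⟨h0, h1, h2⟩ := hyp.v_ne_zero hp
  obtain ⟨e0, e1, e2⟩ := hyp.pd_zero_v hp
  obtain ⟨f0, f1, f2⟩ := hyp.pd_one_v hp
  obtain ⟨g0, g1, g2⟩ := hyp.pd_two_v hp
  have key1 : pd 1 (hh v 1 2) p * v 1 p + hh v 1 2 p * pd 1 (v 1) p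
      = pd 1 (v 2) p * al v 1 p + v 2 p * pd 1 (al v 1) p := hyp.pd_hh_succ hp 1 1
  have key2 := hyp.pd_hh_two_one hp 2
  have key := hyp.holiii 1 2 0 (by decide) (by decide) (by decide) p hp
  generalize hP : pd 1 (hh v 1 2) p = P at *
  generalize hQ : pd 2 (hh v 2 1) p = Q at *
  simp only [hh, e1, e2, f1, f2, g0, g1, g2] at key key1 key2
  clear hP hQ e0 e1 e2 f0 f1 f2 g0 g1 g2 hyp
  linear_combination (norm := (field_simp; ring)) key - key1 / v 1 p - key2 / (v 0 p ^ 4 * v 2 p)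

theorem pd_zero_al_zero (hyp : Hypo U v V c H) (hp : p ∈ U) :
    pd 0 (al v 0) p
      = (1 / (v 1 p) ^ 4) * (3 * (v 1 p) ^ 4 - (v 2 p) ^ 4) * (al v 0 p) ^ 2
        - ((v 0 p) ^ 6 / (v 2 p) ^ 8) * (3 * (v 0 p) ^ 2 - 2 * (v 2 p) ^ 2) * (al v 1 p) ^ 2
        + ((v 1 p) ^ 4 / ((v 0 p) ^ 2 * (v 2 p) ^ 4)) * (3 * (v 0 p) ^ 2 + 2 * (v 1 p) ^ 2)
          * (al v 2 p) ^ 2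
        + (1 / (9 * (v 2 p) ^ 4)) * (5 * (v 0 p) ^ 4 + 2 * (v 1 p) ^ 2 * (v 2 p) ^ 2)
        - ((v 0 p) ^ 2 * (v 1 p) ^ 2 / (v 2 p) ^ 2) * c
        + (v 0 p * v 1 p / (18 * (v 2 p) ^ 3))
          * ((v 1 p) ^ 2 + (v 2 p) ^ 2 - 2 * v 0 p * v 1 p * v 2 p * H) * H := by
  obtain ⟨h0, h1, h2⟩ := hyp.v_ne_zero hp
  have hb := hyp.ansatz_v p hp
  rw [(solve_gauss_system h0 h1 h2 (hyp.gauss_zero_one hp) (hyp.gauss_zero_two hp)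
    (hyp.gauss_one_two hp)).1, hyp.ansatz_V1 p hp, hyp.ansatz_V2 p hp, hyp.ansatz_V3 p hp]
  clear hyp hp
  field_simp
  grind

theorem pd_one_al_one (hyp : Hypo U v V c H) (hp : p ∈ U) :
    pd 1 (al v 1) p
      = -((v 2 p) ^ 4 / ((v 0 p) ^ 4 * (v 1 p) ^ 2)) * (3 * (v 1 p) ^ 2 + 2 * (v 2 p) ^ 2)
          * (al v 0 p) ^ 2
        - (1 / (v 2 p) ^ 4) * ((v 0 p) ^ 4 - 3 * (v 2 p) ^ 4) * (al v 1 p) ^ 2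
        - ((v 1 p) ^ 6 / (v 0 p) ^ 8) * (2 * (v 0 p) ^ 2 + 3 * (v 1 p) ^ 2) * (al v 2 p) ^ 2
        - (1 / (9 * (v 0 p) ^ 4)) * (5 * (v 1 p) ^ 4 - 2 * (v 0 p) ^ 2 * (v 2 p) ^ 2)
        + ((v 1 p) ^ 2 * (v 2 p) ^ 2 / (v 0 p) ^ 2) * c
        - (v 1 p * v 2 p / (18 * (v 0 p) ^ 3))
          * ((v 0 p) ^ 2 - (v 2 p) ^ 2 - 2 * v 0 p * v 1 p * v 2 p * H) * H := by
  obtain ⟨h0, h1, h2⟩ := hyp.v_ne_zero hp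
  have hb := hyp.ansatz_v p hp
  rw [(solve_gauss_system h0 h1 h2 (hyp.gauss_zero_one hp) (hyp.gauss_zero_two hp)
    (hyp.gauss_one_two hp)).2.1, hyp.ansatz_V1 p hp, hyp.ansatz_V2 p hp, hyp.ansatz_V3 p hp]
  clear hyp hp
  field_simp
  grind

theorem pd_two_al_two (hyp : Hypo U v V c H) (hp : p ∈ U) :
    pd 2 (al v 2) p
      = ((v 2 p) ^ 6 / (v 1 p) ^ 8) * (2 * (v 1 p) ^ 2 + 3 * (v 2 p) ^ 2) * (al v 0 p) ^ 2
        + ((v 0 p) ^ 4 / ((v 1 p) ^ 4 * (v 2 p) ^ 2)) * (2 * (v 0 p) ^ 2 - 3 * (v 2 p) ^ 2)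
          * (al v 1 p) ^ 2
        + (1 / (v 0 p) ^ 4) * (3 * (v 0 p) ^ 4 - (v 1 p) ^ 4) * (al v 2 p) ^ 2
        + (1 / (9 * (v 1 p) ^ 4)) * (5 * (v 2 p) ^ 4 + 2 * (v 0 p) ^ 2 * (v 1 p) ^ 2)
        - ((v 0 p) ^ 2 * (v 2 p) ^ 2 / (v 1 p) ^ 2) * c
        - (v 0 p * v 2 p / (18 * (v 1 p) ^ 3))
          * ((v 0 p) ^ 2 + (v 1 p) ^ 2 + 2 * v 0 p * v 1 p * v 2 p * H) * H := by
  obtain ⟨h0, h1, h2⟩ := hyp.v_ne_zero hp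
  have hb := hyp.ansatz_v p hp
  rw [(solve_gauss_system h0 h1 h2 (hyp.gauss_zero_one hp) (hyp.gauss_zero_two hp)
    (hyp.gauss_one_two hp)).2.2, hyp.ansatz_V1 p hp, hyp.ansatz_V2 p hp, hyp.ansatz_V3 p hp]
  clear hyp hp
  field_simp
  grind

end Hypo

theorem statement_1 (U : Set (Fin 3 → ℝ)) (v V : Fin 3 → (Fin 3 → ℝ) → ℝ) (c H : ℝ)
    (hyp : Hypo U v V c H) : ∀ p ∈ U,
    (pd 0 (v 0) p
      = (v 0 p / (v 1 p) ^ 4) * ((v 1 p) ^ 4 + (v 1 p) ^ 2 * (v 2 p) ^ 2 + (v 2 p) ^ 4)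
        * al v 0 p) ∧
    (pd 0 (v 1) p = v 1 p * al v 0 p) ∧
    (pd 0 (v 2) p = ((v 2 p) ^ 5 / (v 1 p) ^ 4) * al v 0 p) ∧
    (pd 1 (v 0) p = ((v 0 p) ^ 5 / (v 2 p) ^ 4) * al v 1 p) ∧
    (pd 1 (v 1) p
      = (v 1 p / (v 2 p) ^ 4) * ((v 0 p) ^ 4 - (v 0 p) ^ 2 * (v 2 p) ^ 2 + (v 2 p) ^ 4)
        * al v 1 p) ∧
    (pd 1 (v 2) p = v 2 p * al v 1 p) ∧
    (pd 2 (v 0) p = v 0 p * al v 2 p) ∧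
    (pd 2 (v 1) p = ((v 1 p) ^ 5 / (v 0 p) ^ 4) * al v 2 p) ∧
    (pd 2 (v 2) p
      = (v 2 p / (v 0 p) ^ 4) * ((v 0 p) ^ 4 + (v 0 p) ^ 2 * (v 1 p) ^ 2 + (v 1 p) ^ 4)
        * al v 2 p) ∧
    (pd 0 (al v 1) p = 2 * ((v 0 p) ^ 2 / (v 1 p) ^ 2) * al v 0 p * al v 1 p) ∧
    (pd 0 (al v 2) p
      = 2 * ((v 2 p) ^ 2 / (v 1 p) ^ 4) * (4 * (v 2 p) ^ 2 + (v 0 p) ^ 2)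
        * al v 0 p * al v 2 p) ∧
    (pd 1 (al v 0) p
      = 2 * ((v 0 p) ^ 2 / (v 2 p) ^ 4) * (4 * (v 0 p) ^ 2 - (v 1 p) ^ 2)
        * al v 0 p * al v 1 p) ∧
    (pd 1 (al v 2) p = 2 * ((v 1 p) ^ 2 / (v 2 p) ^ 2) * al v 1 p * al v 2 p) ∧
    (pd 2 (al v 0) p = -2 * ((v 2 p) ^ 2 / (v 0 p) ^ 2) * al v 0 p * al v 2 p) ∧
    (pd 2 (al v 1) p
      = 2 * ((v 1 p) ^ 2 / (v 0 p) ^ 4) * (4 * (v 1 p) ^ 2 - (v 2 p) ^ 2)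
        * al v 1 p * al v 2 p) ∧
    (pd 0 (al v 0) p
      = (1 / (v 1 p) ^ 4) * (3 * (v 1 p) ^ 4 - (v 2 p) ^ 4) * (al v 0 p) ^ 2
        - ((v 0 p) ^ 6 / (v 2 p) ^ 8) * (3 * (v 0 p) ^ 2 - 2 * (v 2 p) ^ 2) * (al v 1 p) ^ 2
        + ((v 1 p) ^ 4 / ((v 0 p) ^ 2 * (v 2 p) ^ 4)) * (3 * (v 0 p) ^ 2 + 2 * (v 1 p) ^ 2)
          * (al v 2 p) ^ 2
        + (1 / (9 * (v 2 p) ^ 4)) * (5 * (v 0 p) ^ 4 + 2 * (v 1 p) ^ 2 * (v 2 p) ^ 2)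
        - ((v 0 p) ^ 2 * (v 1 p) ^ 2 / (v 2 p) ^ 2) * c
        + (v 0 p * v 1 p / (18 * (v 2 p) ^ 3))
          * ((v 1 p) ^ 2 + (v 2 p) ^ 2 - 2 * v 0 p * v 1 p * v 2 p * H) * H) ∧
    (pd 1 (al v 1) p
      = -((v 2 p) ^ 4 / ((v 0 p) ^ 4 * (v 1 p) ^ 2)) * (3 * (v 1 p) ^ 2 + 2 * (v 2 p) ^ 2)
          * (al v 0 p) ^ 2
        - (1 / (v 2 p) ^ 4) * ((v 0 p) ^ 4 - 3 * (v 2 p) ^ 4) * (al v 1 p) ^ 2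
        - ((v 1 p) ^ 6 / (v 0 p) ^ 8) * (2 * (v 0 p) ^ 2 + 3 * (v 1 p) ^ 2) * (al v 2 p) ^ 2
        - (1 / (9 * (v 0 p) ^ 4)) * (5 * (v 1 p) ^ 4 - 2 * (v 0 p) ^ 2 * (v 2 p) ^ 2)
        + ((v 1 p) ^ 2 * (v 2 p) ^ 2 / (v 0 p) ^ 2) * c
        - (v 1 p * v 2 p / (18 * (v 0 p) ^ 3))
          * ((v 0 p) ^ 2 - (v 2 p) ^ 2 - 2 * v 0 p * v 1 p * v 2 p * H) * H) ∧
    (pd 2 (al v 2) p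
      = ((v 2 p) ^ 6 / (v 1 p) ^ 8) * (2 * (v 1 p) ^ 2 + 3 * (v 2 p) ^ 2) * (al v 0 p) ^ 2
        + ((v 0 p) ^ 4 / ((v 1 p) ^ 4 * (v 2 p) ^ 2)) * (2 * (v 0 p) ^ 2 - 3 * (v 2 p) ^ 2)
          * (al v 1 p) ^ 2
        + (1 / (v 0 p) ^ 4) * (3 * (v 0 p) ^ 4 - (v 1 p) ^ 4) * (al v 2 p) ^ 2
        + (1 / (9 * (v 1 p) ^ 4)) * (5 * (v 2 p) ^ 4 + 2 * (v 0 p) ^ 2 * (v 1 p) ^ 2)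
        - ((v 0 p) ^ 2 * (v 2 p) ^ 2 / (v 1 p) ^ 2) * c
        - (v 0 p * v 2 p / (18 * (v 1 p) ^ 3))
          * ((v 0 p) ^ 2 + (v 1 p) ^ 2 + 2 * v 0 p * v 1 p * v 2 p * H) * H) := by
  intro p hp
  obtain ⟨e0, e1, e2⟩ := hyp.pd_zero_v hp
  obtain ⟨f0, f1, f2⟩ := hyp.pd_one_v hp
  obtain ⟨g0, g1, g2⟩ := hyp.pd_two_v hp
  exact ⟨e0, e1, e2, f0, f1, f2, g0, g1, g2, hyp.pd_zero_al_one hp, hyp.pd_zero_al_two hp,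
    hyp.pd_one_al_zero hp, hyp.pd_one_al_two hp, hyp.pd_two_al_zero hp, hyp.pd_two_al_one hp,
    hyp.pd_zero_al_zero hp, hyp.pd_one_al_one hp, hyp.pd_two_al_two hp⟩
end
end

section
/- Under the holonomic system hypotheses with the conformally flat constant-mean-curvature ansatz, one has v_j^5 h_{ki} = v_i^5 h_{kj} on U for all pairwise distinct indices i, j, k ∈ {1,2,3}. -/
noncomputable section

/-- Elimination behind `fifth_power_relation`: primes denote derivatives in the direction of `X`. -/
lemma fifth_power_algebra {X Y Z X' Y' Z' W W' T H a b c : ℝ}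
    (hb : b ^ 2 = 1) (hc : c ^ 2 = 1)
    (hq : a * X ^ 2 + b * Y ^ 2 + c * Z ^ 2 = 0)
    (hq' : a * X * X' + b * Y * Y' + c * Z * Z' = 0)
    (hW : 3 * (X * Z * W) = c * Z ^ 2 - a * X ^ 2 + H * (X * Y * Z))
    (hW' : 3 * (X' * Z * W + X * Z' * W + X * Z * W') =
      2 * c * Z * Z' - 2 * a * X * X' + H * (X' * Y * Z + X * Y' * Z + X * Y * Z'))
    (hT : 3 * (Y * Z * T) = b * Y ^ 2 - c * Z ^ 2 + H * (X * Y * Z))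
    (hWT : X * W' = Y' * T) : Z ^ 5 * Y' = Y ^ 5 * Z' := by
  have h₁ : Y * Z * X' * (c * Z ^ 2 + a * X ^ 2) - X * Y * Z' * (c * Z ^ 2 + a * X ^ 2)
      + X * Z * Y' * (b * Y ^ 2 - c * Z ^ 2) = 0 := by
    linear_combination X * Y * Z * hW' - (Y * Z * X' + X * Y * Z') * hW - X * Z * Y' * hT
      - 3 * X * Y * Z ^ 2 * hWT
  have h₂ : -b * Y ^ 3 * Z * X' + b * X * Y ^ 3 * Z' + X * Z * Y' * (b * Y ^ 2 - c * Z ^ 2) = 0 := by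
    linear_combination h₁ + (-Y * Z * X' + X * Y * Z') * hq
  linear_combination a * X * h₂ + b * Y ^ 3 * Z * hq' - (b * Y ^ 3 * Z'
      + Z * Y' * (b * Y ^ 2 - c * Z ^ 2)) * hq + Y ^ 5 * Z' * hb
    - Z ^ 5 * Y' * hc

lemma hasDerivAt_pd_line {U : Set (Fin 3 → ℝ)} {f : (Fin 3 → ℝ) → ℝ} (hU : IsOpen U)
    (hf : ContDiffOn ℝ (⊤ : ℕ∞) f U) {p : Fin 3 → ℝ} (hp : p ∈ U) (k : Fin 3) :
    HasDerivAt (fun t : ℝ => f (p + t • Pi.single k 1)) (pd k f p) 0 := by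
  have h := ((hf.contDiffAt (hU.mem_nhds hp)).differentiableAt (by simp)).hasFDerivAt
  exact h.hasLineDerivAt (Pi.single k 1)

/-- The ansatz is invariant under cyclic permutations once the signs of the quadratic relation are
recorded as `a`, `b`, `d`. -/
lemma fifth_power_relation {U : Set (Fin 3 → ℝ)} {v V : Fin 3 → (Fin 3 → ℝ) → ℝ} {c H : ℝ}
    (hyp : Hypo U v V c H) {p : Fin 3 → ℝ} (hp : p ∈ U) {i j k : Fin 3} (hki : i ≠ k)
    {a b d : ℝ} (hb : b ^ 2 = 1) (hd : d ^ 2 = 1)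
    (hq : ∀ q ∈ U, a * v k q ^ 2 + b * v i q ^ 2 + d * v j q ^ 2 = 0)
    (hVi : ∀ q ∈ U, 3 * (v k q * v j q * V i q) =
      d * v j q ^ 2 - a * v k q ^ 2 + H * (v k q * v i q * v j q))
    (hVk : ∀ q ∈ U, 3 * (v i q * v j q * V k q) =
      b * v i q ^ 2 - d * v j q ^ 2 + H * (v k q * v i q * v j q)) :
    v j p ^ 5 * hh v k i p = v i p ^ 5 * hh v k j p := by
  have hU := hyp.hopen
  have hX := hasDerivAt_pd_line hU (hyp.smooth_v k) hp k
  have hY := hasDerivAt_pd_line hU (hyp.smooth_v i) hp k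
  have hZ := hasDerivAt_pd_line hU (hyp.smooth_v j) hp k
  have hW := hasDerivAt_pd_line hU (hyp.smooth_V i) hp k
  have hmem : ∀ᶠ t : ℝ in nhds 0, p + t • (Pi.single k 1 : Fin 3 → ℝ) ∈ U := by
    have hc : Continuous fun t : ℝ => p + t • (Pi.single k 1 : Fin 3 → ℝ) := by fun_prop
    exact hc.continuousAt.eventually_mem (hU.mem_nhds (by simpa using hp))
  have hq' := ((((hX.pow 2).const_mul a).add ((hY.pow 2).const_mul b)).add
    ((hZ.pow 2).const_mul d)).unique
      ((hasDerivAt_const (0 : ℝ) (0 : ℝ)).congr_of_eventuallyEq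
        (hmem.mono fun t ht => hq _ ht))
  have hVi' := (((hX.mul hZ).mul hW).const_mul 3).unique
    (((((hZ.pow 2).const_mul d).sub ((hX.pow 2).const_mul a)).add
      (((hX.mul hY).mul hZ).const_mul H)).congr_of_eventuallyEq
        (hmem.mono fun t ht => hVi _ ht))
  simp only [zero_smul, add_zero, Pi.mul_apply] at hq' hVi'
  have hk := (hyp.pos k p hp).ne'
  have hcod := hyp.holiv i k hki p hp
  have key : v j p ^ 5 * pd k (v i) p = v i p ^ 5 * pd k (v j) p := by
    refine fifth_power_algebra (X' := pd k (v k) p) (W' := pd k (V i) p) (H := H) hb hd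
      (hq p hp) ?_ (hVi p hp) ?_ (hVk p hp) ?_
    · linear_combination hq' / 2
    · linear_combination hVi'
    · rw [hcod, hh]
      field_simp
  rw [hh, hh]
  linear_combination (1 / v k p) * key

theorem statement_3 (U : Set (Fin 3 → ℝ)) (v V : Fin 3 → (Fin 3 → ℝ) → ℝ) (c H : ℝ)
    (hyp : Hypo U v V c H) : ∀ p ∈ U, ∀ i j k : Fin 3, i ≠ j → j ≠ k → i ≠ k →
    (v j p) ^ 5 * hh v k i p = (v i p) ^ 5 * hh v k j p := by
  intro p hp i j k hij hjk hik
  have hx : ∀ q ∈ U, v 0 q ≠ 0 := fun q hq => (hyp.pos 0 q hq).ne'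
  have hy : ∀ q ∈ U, v 1 q ≠ 0 := fun q hq => (hyp.pos 1 q hq).ne'
  have hz : ∀ q ∈ U, v 2 q ≠ 0 := fun q hq => (hyp.pos 2 q hq).ne'
  have hV₀ : ∀ q ∈ U, 3 * (v 1 q * v 2 q * V 0 q) =
      -v 1 q ^ 2 - v 2 q ^ 2 + H * (v 0 q * v 1 q * v 2 q) := fun q hq => by
    have := hy q hq
    have := hz q hq
    rw [hyp.ansatz_V1 q hq]
    field_simp
    ring
  have hV₁ : ∀ q ∈ U, 3 * (v 0 q * v 2 q * V 1 q) =
      v 2 q ^ 2 - v 0 q ^ 2 + H * (v 0 q * v 1 q * v 2 q) := fun q hq => by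
    have := hx q hq
    have := hz q hq
    rw [hyp.ansatz_V2 q hq]
    field_simp
    ring
  have hV₂ : ∀ q ∈ U, 3 * (v 0 q * v 1 q * V 2 q) =
      v 0 q ^ 2 + v 1 q ^ 2 + H * (v 0 q * v 1 q * v 2 q) := fun q hq => by
    have := hx q hq
    have := hy q hq
    rw [hyp.ansatz_V3 q hq]
    field_simp
  have h₀ : v 2 p ^ 5 * hh v 0 1 p = v 1 p ^ 5 * hh v 0 2 p :=
    fifth_power_relation hyp hp (a := 1) (b := -1) (d := 1) (by decide) (by norm_num)
      (by norm_num) (fun q hq => by linear_combination -hyp.ansatz_v q hq)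
      (fun q hq => by linear_combination hV₁ q hq) (fun q hq => by linear_combination hV₀ q hq)
  have h₁ : v 0 p ^ 5 * hh v 1 2 p = v 2 p ^ 5 * hh v 1 0 p :=
    fifth_power_relation hyp hp (a := -1) (b := 1) (d := 1) (by decide) (by norm_num)
      (by norm_num) (fun q hq => by linear_combination -hyp.ansatz_v q hq)
      (fun q hq => by linear_combination hV₂ q hq) (fun q hq => by linear_combination hV₁ q hq)
  have h₂ : v 1 p ^ 5 * hh v 2 0 p = v 0 p ^ 5 * hh v 2 1 p :=
    fifth_power_relation hyp hp (a := 1) (b := 1) (d := -1) (by decide) (by norm_num)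
      (by norm_num) (fun q hq => by linear_combination -hyp.ansatz_v q hq)
      (fun q hq => by linear_combination hV₀ q hq) (fun q hq => by linear_combination hV₂ q hq)
  fin_cases i <;> fin_cases j <;> fin_cases k <;>
    first
    | exact absurd rfl hij
    | exact absurd rfl hjk
    | exact absurd rfl hik
    | exact h₀
    | exact h₁
    | exact h₂
    | exact h₀.symm
    | exact h₁.symm
    | exact h₂.symm
end
end

section
/- (Lemma 2.2) Under the holonomic system hypotheses with the conformally flat constant-mean-curvature ansatz, if v1 = v3 everywhere on U, then H = 0. -/
noncomputable section

theorem pd_eq_of_eqOn {U : Set (Fin 3 → ℝ)} (hU : IsOpen U) {f g : (Fin 3 → ℝ) → ℝ}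
    (h : ∀ p ∈ U, f p = g p) {p : Fin 3 → ℝ} (hp : p ∈ U) (i : Fin 3) :
    pd i f p = pd i g p := by
  have he : f =ᶠ[nhds p] g := Filter.eventually_of_mem (hU.mem_nhds hp) h
  unfold pd
  rw [he.fderiv_eq]

theorem pd_const_add_const_mul {g : (Fin 3 → ℝ) → ℝ} {p : Fin 3 → ℝ}
    (hg : DifferentiableAt ℝ g p) (a b : ℝ) (i : Fin 3) :
    pd i (fun q => a + b * g q) p = b * pd i g p := by
  unfold pd
  rw [fderiv_const_add, fderiv_const_mul hg]
  simp

theorem pd_const (a : ℝ) (i : Fin 3) (p : Fin 3 → ℝ) : pd i (fun _ => a) p = 0 := by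
  simp [pd]

theorem statement_4 (U : Set (Fin 3 → ℝ)) (v V : Fin 3 → (Fin 3 → ℝ) → ℝ) (c H : ℝ)
    (hyp : Hypo U v V c H) : (∀ p ∈ U, v 0 p = v 2 p) → H = 0 := by
  intro h02
  obtain ⟨r, hr⟩ : ∃ r : ℝ, r = √2 := ⟨_, rfl⟩
  have hr0 : 0 < r := hr ▸ by positivity
  have hr2 : r ^ 2 = 2 := by rw [hr]; norm_num
  have h20 : ∀ q ∈ U, v 2 q = 0 + 1 * v 0 q := fun q hq => by rw [h02 q hq]; ring
  have h10 : ∀ q ∈ U, v 1 q = 0 + r * v 0 q := fun q hq => by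
    have h0 := hyp.pos 0 q hq
    have h1 := hyp.pos 1 q hq
    have ha := hyp.ansatz_v q hq
    rw [← h02 q hq] at ha
    rw [zero_add]
    refine (pow_left_inj₀ h1.le (by positivity) two_ne_zero).1 ?_
    rw [mul_pow, hr2, ha]
    ring
  have hV0 : ∀ q ∈ U, V 0 q = -(r / 2) + H / 3 * v 0 q := fun q hq => by
    have h0 := hyp.pos 0 q hq
    rw [hyp.ansatz_V1 q hq, h10 q hq, h20 q hq]
    field_simp
    linear_combination v 0 q ^ 2 * hr2
  have hV1 : ∀ q ∈ U, V 1 q = 0 + r * H / 3 * v 0 q := fun q hq => by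
    have h0 := hyp.pos 0 q hq
    rw [hyp.ansatz_V2 q hq, h10 q hq, h20 q hq]
    field_simp
    ring
  have hV2 : ∀ q ∈ U, V 2 q = r / 2 + H / 3 * v 0 q := fun q hq => by
    have h0 := hyp.pos 0 q hq
    rw [hyp.ansatz_V3 q hq, h10 q hq, h20 q hq]
    field_simp
    linear_combination -(v 0 q ^ 2) * hr2
  have pd_affine : ∀ {f : (Fin 3 → ℝ) → ℝ} {a b : ℝ}, (∀ q ∈ U, f q = a + b * v 0 q) →
      ∀ q ∈ U, ∀ i, pd i f q = b * pd i (v 0) q := fun {f a b} hf q hq i => by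
    have hd : DifferentiableAt ℝ (v 0) q :=
      ((hyp.smooth_v 0).contDiffAt (hyp.hopen.mem_nhds hq)).differentiableAt (by simp)
    rw [pd_eq_of_eqOn hyp.hopen hf hq, pd_const_add_const_mul hd]
  have hpd2 : ∀ q ∈ U, pd 2 (v 0) q = 0 := fun q hq => by
    have h0 := hyp.pos 0 q hq
    have h := hyp.holiv 0 2 (by decide) q hq
    rw [pd_affine hV0 q hq, hV2 q hq, hh, h20 q hq] at h
    field_simp at h
    have : r * pd 2 (v 0) q = 0 := by linarith
    exact (mul_eq_zero.1 this).resolve_left hr0.ne'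
  have hpd0 : ∀ q ∈ U, pd 0 (v 0) q = 0 := fun q hq => by
    have h0 := hyp.pos 0 q hq
    have h := hyp.holiv 2 0 (by decide) q hq
    rw [pd_affine hV2 q hq, hV0 q hq, hh, pd_affine h20 q hq] at h
    field_simp at h
    have : r * pd 0 (v 0) q = 0 := by linarith
    exact (mul_eq_zero.1 this).resolve_left hr0.ne'
  have hh01 : ∀ q ∈ U, hh v 0 1 q = 0 := fun q hq => by
    rw [hh, pd_affine h10 q hq, hpd0 q hq]; simp
  have hh21 : ∀ q ∈ U, hh v 2 1 q = 0 := fun q hq => by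
    rw [hh, pd_affine h10 q hq, hpd2 q hq]; simp
  have hh12 : ∀ q ∈ U, hh v 1 2 q = hh v 1 0 q := fun q hq => by
    rw [hh, hh, pd_affine h20 q hq, one_mul]
  obtain ⟨p, hp⟩ := hyp.hconn.nonempty
  have h0 := hyp.pos 0 p hp
  have e1 := hyp.holiii 0 1 2 (by decide) (by decide) (by decide) p hp
  have e2 := hyp.holiii 1 2 0 (by decide) (by decide) (by decide) p hp
  rw [pd_eq_of_eqOn hyp.hopen hh01 hp, pd_const, hh21 p hp, hV0 p hp, hV1 p hp] at e1
  rw [pd_eq_of_eqOn hyp.hopen hh21 hp, pd_const, hh01 p hp, pd_eq_of_eqOn hyp.hopen hh12 hp,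
    hV1 p hp, hV2 p hp, h20 p hp] at e2
  have key : v 0 p * H = 0 := by
    linear_combination (3 / 2) * (e2 - e1) - (1 / 2) * v 0 p * H * hr2
  exact (mul_eq_zero.1 key).resolve_left h0.ne'
end
end

section
/- (Lemma 2.3) Under the holonomic system hypotheses with the conformally flat constant-mean-curvature ansatz, define α1 := (1/v2) ∂v2/∂u1, α2 := (1/v3) ∂v3/∂u2, α3 := (1/v1) ∂v1/∂u3. Then there is no nonempty open subset of U on which α1, α2 and α3 all vanish identically. -/
noncomputable section

theorem hasDerivAt_line_pd {f : (Fin 3 → ℝ) → ℝ} {p : Fin 3 → ℝ}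
    (hf : DifferentiableAt ℝ f p) (i : Fin 3) :
    HasDerivAt (fun t : ℝ => f (p + t • Pi.single i 1)) (pd i f p) 0 := by
  have h : HasFDerivAt f (fderiv ℝ f p) p := hf.hasFDerivAt
  exact h.hasLineDerivAt (Pi.single i 1)

theorem pd_eq_zero_of_eqOn_zero {W : Set (Fin 3 → ℝ)} (hW : IsOpen W)
    {f : (Fin 3 → ℝ) → ℝ} (hf : ∀ q ∈ W, f q = 0) {p : Fin 3 → ℝ} (hp : p ∈ W) (i : Fin 3) :
    pd i f p = 0 := by
  have h : f =ᶠ[nhds p] fun _ => (0 : ℝ) := Filter.eventually_of_mem (hW.mem_nhds hp) hf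
  simp [pd, h.fderiv_eq]

/-- If `z² = α x² + β y²` with `α² = 1`, and both `z` and `k (x / y - α β y / x) + m z` are
stationary at `t`, then so are `x` and `y`. -/
theorem deriv_eq_zero_of_stationary {x y z F : ℝ → ℝ} {x' y' α β k m t : ℝ}
    (hα : α ^ 2 = 1) (hk : k ≠ 0)
    (hx : HasDerivAt x x' t) (hy : HasDerivAt y y' t)
    (hz : HasDerivAt z 0 t) (hF : HasDerivAt F 0 t)
    (hx0 : x t ≠ 0) (hy0 : y t ≠ 0) (hz0 : z t ≠ 0)
    (hq : ∀ᶠ s in nhds t, z s ^ 2 = α * x s ^ 2 + β * y s ^ 2)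
    (hFeq : ∀ᶠ s in nhds t, F s = k * (x s / y s - α * β * (y s / x s)) + m * z s) :
    x' = 0 ∧ y' = 0 := by
  have hquad := hq.self_of_nhds
  have hlin : α * x t * x' + β * y t * y' = 0 := by
    have h := (hz.pow 2).unique
      ((((hx.pow 2).const_mul α).add ((hy.pow 2).const_mul β)).congr_of_eventuallyEq hq)
    simp only [Nat.cast_ofNat, Nat.add_one_sub_one, pow_one, mul_zero] at h
    linarith
  have hwr : x' * y t - x t * y' = 0 := by
    have h := hF.unique (((((hx.div hy hy0).sub
      ((hy.div hx hx0).const_mul (α * β))).const_mul k).add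
      (hz.const_mul m)).congr_of_eventuallyEq hFeq)
    field_simp at h
    have h' : k * α * z t ^ 2 * (x' * y t - x t * y') = 0 := by
      rw [hquad]
      linear_combination -h + k * x t ^ 2 * (x' * y t - x t * y') * hα
    have hα0 : α ≠ 0 := by rintro rfl; norm_num at hα
    simpa [hk, hα0, hz0] using h'
  have hy' : z t ^ 2 * y' = 0 := by
    rw [hquad]
    linear_combination y t * hlin - α * x t * hwr
  have hy'' : y' = 0 := by simpa [hz0] using hy'
  refine ⟨?_, hy''⟩
  simpa [hy'', hy0] using hwr

theorem pd_eq_zero_of_stationary {x y z F : (Fin 3 → ℝ) → ℝ} {α β k m : ℝ} {p : Fin 3 → ℝ}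
    {i : Fin 3} (hα : α ^ 2 = 1) (hk : k ≠ 0)
    (hx : DifferentiableAt ℝ x p) (hy : DifferentiableAt ℝ y p)
    (hz : DifferentiableAt ℝ z p) (hF : DifferentiableAt ℝ F p)
    (hzi : pd i z p = 0) (hFi : pd i F p = 0)
    (hx0 : x p ≠ 0) (hy0 : y p ≠ 0) (hz0 : z p ≠ 0)
    (hq : ∀ᶠ q in nhds p, z q ^ 2 = α * x q ^ 2 + β * y q ^ 2)
    (hFeq : ∀ᶠ q in nhds p, F q = k * (x q / y q - α * β * (y q / x q)) + m * z q) :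
    pd i x p = 0 ∧ pd i y p = 0 := by
  have hline : Filter.Tendsto (fun t : ℝ => p + t • (Pi.single i 1 : Fin 3 → ℝ))
      (nhds 0) (nhds p) := by
    have h : Continuous fun t : ℝ => p + t • (Pi.single i 1 : Fin 3 → ℝ) := by fun_prop
    simpa using h.tendsto 0
  have hz' := hasDerivAt_line_pd hz i
  have hF' := hasDerivAt_line_pd hF i
  rw [hzi] at hz'
  rw [hFi] at hF'
  exact deriv_eq_zero_of_stationary hα hk (hasDerivAt_line_pd hx i) (hasDerivAt_line_pd hy i)
    hz' hF' (by simpa using hx0) (by simpa using hy0) (by simpa using hz0)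
    (hline.eventually hq) (hline.eventually hFeq)

namespace Hypo

variable {U W : Set (Fin 3 → ℝ)} {v V : Fin 3 → (Fin 3 → ℝ) → ℝ} {c H : ℝ}

theorem pd_eq_zero_of_al_eq_zero (hyp : Hypo U v V c H) {p : Fin 3 → ℝ} (hp : p ∈ U)
    (hal : ∀ i, al v i p = 0) (i j : Fin 3) : pd i (v j) p = 0 := by
  have hU := hyp.hopen.mem_nhds hp
  have dv : ∀ i, DifferentiableAt ℝ (v i) p := fun i =>
    ((hyp.smooth_v i).contDiffAt hU).differentiableAt (by simp)
  have dV : ∀ i, DifferentiableAt ℝ (V i) p := fun i =>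
    ((hyp.smooth_V i).contDiffAt hU).differentiableAt (by simp)
  have h0 : ∀ i, v i p ≠ 0 := fun i => (hyp.pos i p hp).ne'
  have hv : ∀ i, pd i (v (i + 1)) p = 0 := fun i => by
    simpa [al, h0] using hal i
  have hV : ∀ i, pd i (V (i + 1)) p = 0 := fun i => by
    rw [hyp.holiv (i + 1) i (by fin_cases i <;> decide) p hp, hh, hv i]
    simp
  have d1 := pd_eq_zero_of_stationary (α := 1) (β := 1) (k := -(1 / 3)) (m := H / 3)
    (by norm_num) (by norm_num) (dv 0) (dv 2) (dv 1) (dV 1) (hv 0) (hV 0) (h0 0) (h0 2) (h0 1)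
    (by filter_upwards [hU] with q hq using by rw [hyp.ansatz_v q hq]; ring)
    (by filter_upwards [hU] with q hq using by rw [hyp.ansatz_V2 q hq]; ring)
  have d2 := pd_eq_zero_of_stationary (α := -1) (β := 1) (k := 1 / 3) (m := H / 3)
    (by norm_num) (by norm_num) (dv 0) (dv 1) (dv 2) (dV 2) (hv 1) (hV 1) (h0 0) (h0 1) (h0 2)
    (by filter_upwards [hU] with q hq using by rw [hyp.ansatz_v q hq]; ring)
    (by filter_upwards [hU] with q hq using by rw [hyp.ansatz_V3 q hq]; ring)
  have d3 := pd_eq_zero_of_stationary (α := 1) (β := -1) (k := -(1 / 3)) (m := H / 3)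
    (by norm_num) (by norm_num) (dv 1) (dv 2) (dv 0) (dV 0) (hv 2) (hV 2) (h0 1) (h0 2) (h0 0)
    (by filter_upwards [hU] with q hq using by rw [hyp.ansatz_v q hq]; ring)
    (by filter_upwards [hU] with q hq using by rw [hyp.ansatz_V1 q hq]; ring)
  fin_cases i <;> fin_cases j
  exacts [d1.1, hv 0, d1.2, d2.1, d2.2, hv 1, hv 2, d3.1, d3.2]

theorem mul_add_mul_eq_zero (hyp : Hypo U v V c H) (hW : IsOpen W) (hWU : W ⊆ U)
    (hal : ∀ q ∈ W, ∀ i, al v i q = 0) {p : Fin 3 → ℝ} (hp : p ∈ W) {i j k : Fin 3}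
    (hij : i ≠ j) (hjk : j ≠ k) (hik : i ≠ k) :
    V i p * V j p + c * v i p * v j p = 0 := by
  have hhz : ∀ i j, ∀ q ∈ W, hh v i j q = 0 := fun i j q hq => by
    rw [hh, hyp.pd_eq_zero_of_al_eq_zero (hWU hq) (hal q hq), mul_zero]
  have h := hyp.holiii i j k hij hjk hik p (hWU hp)
  rw [pd_eq_zero_of_eqOn_zero hW (hhz i j) hp, pd_eq_zero_of_eqOn_zero hW (hhz j i) hp,
    hhz k i p hp] at h
  linarith

/-- The `V i p / v i p` are pairwise distinct, so their pairwise products cannot all agree. -/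
theorem not_forall_mul_add_mul_eq_zero (hyp : Hypo U v V c H) {p : Fin 3 → ℝ} (hp : p ∈ U)
    (h01 : V 0 p * V 1 p + c * v 0 p * v 1 p = 0)
    (h12 : V 1 p * V 2 p + c * v 1 p * v 2 p = 0)
    (h02 : V 0 p * V 2 p + c * v 0 p * v 2 p = 0) : False := by
  have hq := hyp.ansatz_v p hp
  have e0 := hyp.ansatz_V1 p hp
  have e1 := hyp.ansatz_V2 p hp
  have e2 := hyp.ansatz_V3 p hp
  have p0 := hyp.pos 0 p hp
  have p1 := hyp.pos 1 p hp
  have p2 := hyp.pos 2 p hp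
  generalize v 0 p = a at *
  generalize v 1 p = b at *
  generalize v 2 p = w at *
  generalize V 0 p = A at *
  generalize V 1 p = B at *
  generalize V 2 p = C at *
  have n01 : A * b - B * a ≠ 0 := by
    have h : w * (A * b - B * a) = -w ^ 2 := by
      rw [e0, e1]; field_simp; linear_combination -hq
    intro h'
    rw [h'] at h
    nlinarith [pow_pos p2 2]
  have n12 : B * w - C * b ≠ 0 := by
    have h : a * (B * w - C * b) = -a ^ 2 := by
      rw [e1, e2]; field_simp; linear_combination -hq
    intro h'
    rw [h'] at h
    nlinarith [pow_pos p0 2]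
  have n02 : A * w - C * a ≠ 0 := by
    have h : b * (A * w - C * a) = -b ^ 2 := by
      rw [e0, e2]; field_simp; linear_combination hq
    intro h'
    rw [h'] at h
    nlinarith [pow_pos p1 2]
  have hC : C = 0 := by
    have h : C * (A * b - B * a) = 0 := by linear_combination b * h02 - a * h12
    simpa [n01] using h
  have hA : A = 0 := by
    have h : A * (B * w - C * b) = 0 := by linear_combination w * h01 - b * h02
    simpa [n12] using h
  simp [hA, hC] at n02

end Hypo

theorem statement_5 (U : Set (Fin 3 → ℝ)) (v V : Fin 3 → (Fin 3 → ℝ) → ℝ) (c H : ℝ)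
    (hyp : Hypo U v V c H) : ∀ W : Set (Fin 3 → ℝ), IsOpen W → W ⊆ U → W.Nonempty →
    ¬ (∀ p ∈ W, al v 0 p = 0 ∧ al v 1 p = 0 ∧ al v 2 p = 0) := by
  rintro W hW hWU ⟨p, hp⟩ h
  have hal : ∀ q ∈ W, ∀ i, al v i q = 0 := fun q hq i => by
    obtain ⟨h0, h1, h2⟩ := h q hq
    fin_cases i
    exacts [h0, h1, h2]
  exact hyp.not_forall_mul_add_mul_eq_zero (hWU hp)
    (hyp.mul_add_mul_eq_zero hW hWU hal hp (k := 2) (by decide) (by decide) (by decide))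
    (hyp.mul_add_mul_eq_zero hW hWU hal hp (k := 0) (by decide) (by decide) (by decide))
    (hyp.mul_add_mul_eq_zero hW hWU hal hp (k := 1) (by decide) (by decide) (by decide))
end
end
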